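/- Let (X, d) be a metric space, let α, β, γ, δ, ε, ζ : X×X → ℝ, and let T : X → X be an (α, β, γ, δ, ε, ζ)-weighted generalized pseudocontraction. Suppose there exist λ : X×X → [0,1] and A ∈ (0,1) such that for all x, y ∈ X, at least one of the following holds: (i) α_λ(x,y) + ζ_λ(x,y) + 2·min{β_λ(x,y), 0} > 0 and −(δ_λ(x,y) + ε_λ(x,y) + 2·min{β_λ(x,y), 0})/(α_λ(x,y) + ζ_λ(x,y) + 2·min{β_λ(x,y), 0}) ≤ A; or (ii) α_λ(y,x) + ε_λ(y,x) + 2·min{γ_λ(y,x), 0} > 0 and −(δ_λ(y,x) + ζ_λ(y,x) + 2·min{γ_λ(y,x), 0})/(α_λ(y,x) + ε_λ(y,x) + 2·min{γ_λ(y,x), 0}) ≤ A. Then for every x ∈ X the sequence (Tⁿx)_{n∈ℕ} is a Cauchy sequence. -/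

import Mathlib

open Filter Topology

/-- `T` is an `(α, β, γ, δ, ε, ζ)`-weighted generalized pseudocontraction. -/
def IsWGPseudocontraction {X : Type*} [MetricSpace X]
    (T : X → X) (α β γ δ ε ζ : X → X → ℝ) : Prop :=
  ∀ x y : X,
    α x y * dist (T x) (T y) ^ 2 + β x y * dist x (T y) ^ 2 +
      γ x y * dist (T x) y ^ 2 + δ x y * dist x y ^ 2 +
      ε x y * dist x (T x) ^ 2 + ζ x y * dist y (T y) ^ 2 ≤ 0

/-- The `l`-weighted combination of two coefficient maps:
`(f, g) ↦ (x, y) ↦ (1 − l(x,y))·f(x,y) + l(x,y)·g(y,x)`.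
With it: `α_λ = wComb l α α`, `β_λ = wComb l β γ`, `γ_λ = wComb l γ β`,
`δ_λ = wComb l δ δ`, `ε_λ = wComb l ε ζ`, `ζ_λ = wComb l ζ ε`. -/
def wComb {X : Type*} (l f g : X → X → ℝ) : X → X → ℝ :=
  fun x y => (1 - l x y) * f x y + l x y * g y x

/-- A weighted generalized pseudocontraction is one for the symmetrized coefficients as well. -/
theorem IsWGPseudocontraction.symmetrize {X : Type*} [MetricSpace X] {T : X → X}
    {α β γ δ ε ζ l : X → X → ℝ} (hT : IsWGPseudocontraction T α β γ δ ε ζ)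
    (hl : ∀ x y, l x y ∈ Set.Icc (0 : ℝ) 1) :
    IsWGPseudocontraction T (wComb l α α) (wComb l β γ) (wComb l γ β) (wComb l δ δ)
      (wComb l ε ζ) (wComb l ζ ε) := by
  intro x y
  have h₁ := mul_nonpos_of_nonneg_of_nonpos (sub_nonneg.2 (hl x y).2) (hT x y)
  have h₂ := mul_nonpos_of_nonneg_of_nonpos (hl x y).1 (hT y x)
  rw [dist_comm (T y) (T x), dist_comm y (T x), dist_comm (T y) x, dist_comm y x] at h₂
  simp only [wComb]
  linarith

theorem two_mul_min_zero_mul_le {a b c : ℝ} (k : ℝ) (hc : 0 ≤ c) (habc : c ≤ a + b) :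
    2 * min k 0 * (a ^ 2 + b ^ 2) ≤ k * c ^ 2 := by
  have hsq : c ^ 2 ≤ 2 * (a ^ 2 + b ^ 2) := by nlinarith [sq_nonneg (a - b)]
  have h₁ := mul_le_mul_of_nonpos_left hsq (min_le_right k 0)
  have h₂ := mul_le_mul_of_nonneg_right (min_le_left k 0) (sq_nonneg c)
  linarith

theorem le_mul_of_add_nonpos_of_neg_div_le {p q u v A : ℝ} (hp : 0 < p) (hq : -(q / p) ≤ A)
    (hu : 0 ≤ u) (h : p * v + q * u ≤ 0) : v ≤ A * u := by
  have hv : v ≤ -(q / p) * u := by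
    rw [← neg_div, div_mul_eq_mul_div, le_div_iff₀ hp]
    linarith
  exact hv.trans (mul_le_mul_of_nonneg_right hq hu)

theorem cauchySeq_iterate_of_dist_sq_le {X : Type*} [MetricSpace X] {T : X → X} {A : ℝ}
    (hA₀ : 0 ≤ A) (hA₁ : A < 1)
    (hT : ∀ x, dist (T x) (T (T x)) ^ 2 ≤ A * dist x (T x) ^ 2) (x : X) :
    CauchySeq (fun n : ℕ => T^[n] x) := by
  have hstep (y : X) : dist (T y) (T (T y)) ≤ √A * dist y (T y) := by
    refine (sq_le_sq₀ dist_nonneg (by positivity)).1 ?_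
    rw [mul_pow, Real.sq_sqrt hA₀]
    exact hT y
  refine cauchySeq_of_le_geometric (√A) (dist x (T x))
    ((Real.sqrt_lt' one_pos).2 (by simpa using hA₁)) fun n => ?_
  induction n with
  | zero => simp
  | succ n ih =>
    simp only [Function.iterate_succ_apply'] at ih ⊢
    calc _ ≤ √A * dist (T^[n] x) (T (T^[n] x)) := hstep _
      _ ≤ √A * (dist x (T x) * √A ^ n) := by gcongr
      _ = _ := by ring

theorem stmt_6 {X : Type*} [MetricSpace X] (α β γ δ ε ζ : X → X → ℝ)
    (T : X → X) (hT : IsWGPseudocontraction T α β γ δ ε ζ)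
    (h : ∃ (l : X → X → ℝ) (A : ℝ), (∀ x y : X, l x y ∈ Set.Icc (0 : ℝ) 1) ∧
      A ∈ Set.Ioo (0 : ℝ) 1 ∧
      ∀ x y : X,
        (0 < wComb l α α x y + wComb l ζ ε x y + 2 * min (wComb l β γ x y) 0 ∧
          -((wComb l δ δ x y + wComb l ε ζ x y + 2 * min (wComb l β γ x y) 0) /
              (wComb l α α x y + wComb l ζ ε x y + 2 * min (wComb l β γ x y) 0)) ≤ A) ∨
        (0 < wComb l α α y x + wComb l ε ζ y x + 2 * min (wComb l γ β y x) 0 ∧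
          -((wComb l δ δ y x + wComb l ζ ε y x + 2 * min (wComb l γ β y x) 0) /
              (wComb l α α y x + wComb l ε ζ y x + 2 * min (wComb l γ β y x) 0)) ≤ A)) :
    ∀ x : X, CauchySeq (fun n : ℕ => T^[n] x) := by
  obtain ⟨l, A, hl, ⟨hA₀, hA₁⟩, h⟩ := h
  have hT' := hT.symmetrize hl
  refine cauchySeq_iterate_of_dist_sq_le hA₀.le hA₁ fun x => ?_
  have htri := dist_triangle x (T x) (T (T x))
  rcases h x (T x) with ⟨hp, hq⟩ | ⟨hp, hq⟩
  · refine le_mul_of_add_nonpos_of_neg_div_le hp hq (sq_nonneg _) ?_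
    have hc := hT' x (T x)
    have hk := two_mul_min_zero_mul_le (wComb l β γ x (T x)) dist_nonneg htri
    rw [dist_self] at hc
    linarith
  · refine le_mul_of_add_nonpos_of_neg_div_le hp hq (sq_nonneg _) ?_
    have hc := hT' (T x) x
    have hk := two_mul_min_zero_mul_le (wComb l γ β (T x) x) dist_nonneg htri
    rw [dist_self, dist_comm (T (T x)) (T x), dist_comm (T (T x)) x, dist_comm (T x) x] at hc
    linarith
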